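/- Let k be an algebraically closed field of characteristic zero and let h = (h_0, h_1, …, h_r) be a finite sequence of positive integers with h_0 = 1 (extended by h_i = 0 for i > r). Then h is the Hilbert function of a graded Artinian k-algebra having the Weak Lefschetz Property if and only if h is a unimodal O-sequence (there is m with h_0 ≤ h_1 ≤ … ≤ h_m ≥ h_{m+1} ≥ … ≥ h_r) such that the positive part of its first difference, namely the sequence c with c_i = max((Δh)_i, 0), is an O-sequence. -/

import Mathlib

/-!
STATEMENT 1 ([HMNW], Proposition 3.5): over an algebraically closed field `k`
of characteristic zero, a finite sequence `h` of positive integers with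
`h_0 = 1` is the Hilbert function of a graded Artinian `k`-algebra with the
Weak Lefschetz Property if and only if `h` is a unimodal O-sequence whose
positive part of the first difference is again an O-sequence.
-/

open MvPolynomial

/-- Greedy top term `m_i` of the `i`-binomial expansion of `a`. -/
def binomExpTop (a i : ℕ) : ℕ :=
  Nat.findGreatest (fun m => Nat.choose m i ≤ a) (a + i)

/-- Macaulay growth function: `macaulayGrow i a = a^⟨i⟩`, with `0^⟨i⟩ = 0`. -/
def macaulayGrow : ℕ → ℕ → ℕ
  | 0, _ => 0
  | (i + 1), a =>
    if a = 0 then 0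
    else Nat.choose (binomExpTop a (i + 1) + 1) (i + 2)
      + macaulayGrow i (a - Nat.choose (binomExpTop a (i + 1)) (i + 1))

/-- O-sequence: `a_0 = 1` and `a_{i+1} ≤ a_i^⟨i⟩` for all `i ≥ 1`. -/
def IsOSequence (a : ℕ → ℕ) : Prop :=
  a 0 = 1 ∧ ∀ i : ℕ, 1 ≤ i → a (i + 1) ≤ macaulayGrow i (a i)

/-- A homogeneous ideal of a polynomial ring. -/
def IsHomogeneousIdeal {k : Type*} [CommSemiring k] {n : ℕ}
    (I : Ideal (MvPolynomial (Fin n) k)) : Prop :=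
  ∀ f ∈ I, ∀ i : ℕ, MvPolynomial.homogeneousComponent i f ∈ I

/-- The degree-`i` graded piece of `R/I`. -/
noncomputable def quotPiece {k : Type*} [Field k] {n : ℕ}
    (I : Ideal (MvPolynomial (Fin n) k)) (i : ℕ) :
    Submodule k (MvPolynomial (Fin n) k ⧸ I) :=
  (MvPolynomial.homogeneousSubmodule (Fin n) k i).map (Ideal.Quotient.mkₐ k I).toLinearMap

/-- The Hilbert function of `R/I`. -/
noncomputable def hilbertFn {k : Type*} [Field k] {n : ℕ}
    (I : Ideal (MvPolynomial (Fin n) k)) (i : ℕ) : ℕ :=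
  Module.finrank k (quotPiece I i)

/-- The Weak Lefschetz Property for `R/I`: there is a linear form `L` such that
multiplication by `L` from each graded piece to the next is injective or
surjective. -/
def hasWLP {k : Type*} [Field k] {n : ℕ} (I : Ideal (MvPolynomial (Fin n) k)) : Prop :=
  ∃ L ∈ MvPolynomial.homogeneousSubmodule (Fin n) k 1,
    ∀ i : ℕ,
      (∀ x ∈ quotPiece I i, Ideal.Quotient.mk I L * x = 0 → x = 0) ∨
      (∀ y ∈ quotPiece I (i + 1), ∃ x ∈ quotPiece I i, Ideal.Quotient.mk I L * x = y)

/-- The positive part of the first difference of `h` (with `h_{-1} = 0`):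
`c_0 = h_0` and `c_{i+1} = max(h_{i+1} - h_i, 0)` (truncated subtraction). -/
def posDiff (h : ℕ → ℕ) : ℕ → ℕ
  | 0 => h 0
  | (i + 1) => h (i + 1) - h i

namespace WLPaux

/-- `a_{<i>}`: the number of non-`x₀` monomials in an initial segment. -/
def zf : ℕ → ℕ → ℕ
  | 0, _ => 0
  | (i + 1), a =>
    if a = 0 then 0
    else Nat.choose (binomExpTop a (i + 1) - 1) (i + 1)
      + zf i (a - Nat.choose (binomExpTop a (i + 1)) (i + 1))

/-- the number of monomials divisible by `x₀` in an initial segment. -/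
def sf : ℕ → ℕ → ℕ
  | 0, _ => 0
  | (i + 1), a =>
    if a = 0 then 0
    else Nat.choose (binomExpTop a (i + 1) - 1) i
      + sf i (a - Nat.choose (binomExpTop a (i + 1)) (i + 1))

lemma top_le (a i : ℕ) : Nat.choose (binomExpTop a (i+1)) (i+1) ≤ a := by
  unfold binomExpTop
  exact Nat.findGreatest_spec (P := fun m => Nat.choose m (i+1) ≤ a) (m := 0) (Nat.zero_le _)
    (by simp)

lemma lt_choose (a i : ℕ) : a < Nat.choose (a + (i+1)) (i+1) := by
  induction i with
  | zero => simp
  | succ i ih =>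
    have : Nat.choose (a + (i+1+1)) (i+1+1) = Nat.choose (a+(i+1)) (i+1) + Nat.choose (a+(i+1)) (i+2) := by
      rw [← add_assoc a (i+1) 1, Nat.choose_succ_succ']
    omega

lemma lt_top (a i : ℕ) : a < Nat.choose (binomExpTop a (i+1) + 1) (i+1) := by
  by_contra hc
  push Not at hc
  have h1 : binomExpTop a (i+1) + 1 ≤ binomExpTop a (i+1) := by
    conv_rhs => unfold binomExpTop
    refine Nat.le_findGreatest (P := fun m => Nat.choose m (i+1) ≤ a) ?_ hc
    by_contra h2
    push Not at h2
    have h3 : a + (i+1) ≤ binomExpTop a (i+1) := by omega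
    have h4 := Nat.choose_le_choose (i+1) h3
    have h5 := lt_choose a i
    have h6 := top_le a i
    omega
  omega

lemma top_eq {a m i : ℕ} (h1 : Nat.choose m (i+1) ≤ a) (h2 : a < Nat.choose (m+1) (i+1)) :
    binomExpTop a (i+1) = m := by
  have h3 := top_le a i
  have h4 := lt_top a i
  rcases lt_trichotomy (binomExpTop a (i+1)) m with h | h | h
  · have := Nat.choose_le_choose (i+1) (show binomExpTop a (i+1) + 1 ≤ m from h)
    omega
  · exact h
  · have := Nat.choose_le_choose (i+1) (show m+1 ≤ binomExpTop a (i+1) from h)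
    omega

lemma decomp (i a : ℕ) (ha : 0 < a) : ∃ m r, i ≤ m ∧ a = Nat.choose (m+1) (i+1) + r ∧
    r < Nat.choose (m+1) i := by
  have h3 := top_le a i
  have h4 := lt_top a i
  have h5 : i + 1 ≤ binomExpTop a (i+1) := by
    by_contra h
    push Not at h
    have := Nat.choose_le_choose (i+1) (show binomExpTop a (i+1) + 1 ≤ i + 1 by omega)
    rw [Nat.choose_self] at this
    omega
  obtain ⟨m, hm⟩ : ∃ m, binomExpTop a (i+1) = m + 1 := ⟨binomExpTop a (i+1) - 1, by omega⟩
  rw [hm] at h3 h4 h5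
  rw [Nat.choose_succ_succ' (m+1)] at h4
  exact ⟨m, a - Nat.choose (m+1) (i+1), by omega, by omega, by omega⟩

lemma star (i m r : ℕ) (hm : i ≤ m) (hr : r < Nat.choose (m+1) i) :
    macaulayGrow (i+1) (Nat.choose (m+1) (i+1) + r) = Nat.choose (m+2) (i+2) + macaulayGrow i r ∧
    zf (i+1) (Nat.choose (m+1) (i+1) + r) = Nat.choose m (i+1) + zf i r ∧
    sf (i+1) (Nat.choose (m+1) (i+1) + r) = Nat.choose m i + sf i r := by
  have hp : 0 < Nat.choose (m+1) (i+1) := Nat.choose_pos (by omega)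
  have ht : binomExpTop (Nat.choose (m+1) (i+1) + r) (i+1) = m+1 := by
    apply top_eq (by omega)
    rw [Nat.choose_succ_succ' (m+1)]
    omega
  have h0 : Nat.choose (m+1) (i+1) + r ≠ 0 := by omega
  refine ⟨?_, ?_, ?_⟩
  · rw [macaulayGrow, if_neg h0, ht]; simp
  · rw [zf, if_neg h0, ht]; simp
  · rw [sf, if_neg h0, ht]; simp

lemma G_zero (i : ℕ) : macaulayGrow i 0 = 0 := by
  cases i <;> simp [macaulayGrow]
lemma zf_zero (i : ℕ) : zf i 0 = 0 := by
  cases i <;> simp [zf]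
lemma sf_zero (i : ℕ) : sf i 0 = 0 := by
  cases i <;> simp [sf]

lemma G_choose (i m : ℕ) : macaulayGrow (i+1) (Nat.choose m (i+1)) = Nat.choose (m+1) (i+2) := by
  by_cases h : i + 1 ≤ m
  · obtain ⟨m, rfl⟩ : ∃ m', m = m' + 1 := ⟨m - 1, by omega⟩
    have := (star i m 0 (by omega) (Nat.choose_pos (by omega))).1
    simpa [G_zero] using this
  · rw [Nat.choose_eq_zero_of_lt (by omega : m < i+1), Nat.choose_eq_zero_of_lt (by omega : m+1 < i+2), G_zero]

lemma G_strict (i : ℕ) : ∀ a, macaulayGrow (i+1) a < macaulayGrow (i+1) (a+1) := by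
  induction i with
  | zero =>
    intro a
    have h1 := G_choose 0 a
    have h2 := G_choose 0 (a+1)
    simp only [zero_add, Nat.choose_one_right] at h1 h2 ⊢
    rw [h1, h2, Nat.choose_succ_succ' (a+1)]
    simp
  | succ i ih =>
    have ihm : StrictMono (macaulayGrow (i+1)) := strictMono_nat_of_lt_succ ih
    intro a
    rcases Nat.eq_zero_or_pos a with rfl | ha
    · have := G_choose (i+1) (i+2)
      rw [Nat.choose_self, Nat.choose_self] at this
      rw [G_zero, zero_add, this]; simp
    · obtain ⟨m, r, hm, rfl, hr⟩ := decomp (i+1) a ha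
      rw [(star (i+1) m r hm hr).1]
      by_cases hr' : r + 1 < Nat.choose (m+1) (i+1)
      · rw [show Nat.choose (m+1) (i+1+1) + r + 1 = Nat.choose (m+1) (i+1+1) + (r + 1) from rfl, (star (i+1) m (r+1) hm hr').1]
        have := ih r
        omega
      · have e : Nat.choose (m+1) (i+1+1) + r + 1 = Nat.choose (m+2) (i+1+1) := by
          rw [Nat.choose_succ_succ' (m+1)]; omega
        rw [e, G_choose, Nat.choose_succ_succ' (m+2)]
        have h1 := ihm hr
        rw [G_choose] at h1
        simp only [add_assoc, Nat.reduceAdd] at *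
        omega

lemma G_strictMono (i : ℕ) : StrictMono (macaulayGrow (i+1)) :=
  strictMono_nat_of_lt_succ (G_strict i)

lemma star' (i m r : ℕ) (hm : i + 1 ≤ m) (hr : r ≤ Nat.choose m (i+1)) :
    macaulayGrow (i+2) (Nat.choose m (i+2) + r) =
      Nat.choose (m+1) (i+3) + macaulayGrow (i+1) r := by
  obtain ⟨m, rfl⟩ : ∃ m', m = m' + 1 := ⟨m - 1, by omega⟩
  rcases Nat.lt_or_ge r (Nat.choose (m+1) (i+1)) with h | h
  · by_cases hm' : i + 1 ≤ m
    · exact (star (i+1) m r hm' h).1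
    · have : m = i := by omega
      subst this
      have : r = 0 := by simpa using h
      subst this
      rw [Nat.choose_eq_zero_of_lt (by omega), G_zero, Nat.choose_eq_zero_of_lt (by omega)]
      simp [G_zero]
  · have : r = Nat.choose (m+1) (i+1) := le_antisymm hr h
    subst this
    have e : Nat.choose (m+1) (i+2) + Nat.choose (m+1) (i+1) = Nat.choose (m+2) (i+2) := by
      have := Nat.choose_succ_succ' (m+1) (i+1)
      simp only [add_assoc, Nat.reduceAdd] at *
      omega
    rw [e, G_choose (i+1), G_choose, Nat.choose_succ_succ' (m+2)]
    simp only [add_assoc, Nat.reduceAdd] at *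
    omega

lemma zf_add_sf (i : ℕ) : ∀ a, sf (i+1) a + zf (i+1) a = a := by
  induction i with
  | zero =>
    intro a
    rcases Nat.eq_zero_or_pos a with rfl | ha
    · simp [sf_zero, zf_zero]
    · obtain ⟨m, r, hm, rfl, hr⟩ := decomp 0 a ha
      have := star 0 m r hm hr
      rw [this.2.1, this.2.2]
      simp at hr
      subst hr
      simp [sf, zf]
      omega
  | succ i ih =>
    intro a
    rcases Nat.eq_zero_or_pos a with rfl | ha
    · simp [sf_zero, zf_zero]
    · obtain ⟨m, r, hm, rfl, hr⟩ := decomp (i+1) a ha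
      have := star (i+1) m r hm hr
      rw [this.2.1, this.2.2, Nat.choose_succ_succ' m]
      have := ih r
      try simp only [add_assoc, Nat.reduceAdd] at *
      omega

lemma sf_one (a : ℕ) : sf 1 a = if a = 0 then 0 else 1 := by
  simp [sf]

lemma bounds (i : ℕ) : ∀ m r, r ≤ Nat.choose (m+1) (i+1) →
    sf (i+1) r ≤ Nat.choose m i ∧ zf (i+1) r ≤ Nat.choose m (i+1) := by
  induction i with
  | zero =>
    intro m r hr
    have h1 := zf_add_sf 0 r
    have h2 := sf_one r
    simp only [zero_add, Nat.choose_zero_right, Nat.choose_one_right] at *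
    split_ifs at h2 <;> omega
  | succ i ih =>
    intro m r hr
    rcases Nat.eq_zero_or_pos r with rfl | ha
    · simp [sf_zero, zf_zero]
    · obtain ⟨m', r', hm, rfl, hr'⟩ := decomp (i+1) r ha
      have h1 := star (i+1) m' r' hm hr'
      rw [h1.2.1, h1.2.2]
      have hle : m' ≤ m := by
        by_contra hc
        push Not at hc
        have h2 := Nat.choose_le_choose (i+1+1) (show m+1+1 ≤ m'+1 by omega)
        have h3 : 0 < Nat.choose (m+1) (i+1) := Nat.choose_pos (by
          by_contra h4
          rw [Nat.choose_eq_zero_of_lt (by omega : m + 1 < i+1+1)] at hr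
          omega)
        rw [Nat.choose_succ_succ' (m+1)] at h2
        try simp only [Nat.succ_eq_add_one] at h2
        omega
      rcases hle.lt_or_eq with h | rfl
      · have h2 := ih m' r' hr'.le
        have h3 := Nat.choose_le_choose (i+1) (show m'+1 ≤ m from h)
        have h4 := Nat.choose_le_choose (i+1+1) (show m'+1 ≤ m from h)
        rw [Nat.choose_succ_succ' m'] at h3 h4
        try simp only [Nat.succ_eq_add_one] at h3 h4
        omega
      · have : r' = 0 := by omega
        subst this
        simp [sf_zero, zf_zero]

lemma G_eq (i : ℕ) : ∀ a, macaulayGrow (i+1) a = a + macaulayGrow (i+1) (zf (i+1) a) := by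
  induction i with
  | zero =>
    intro a
    have h1 := zf_add_sf 0 a
    have h2 := sf_one a
    have h3 := G_choose 0 a
    have h4 := G_choose 0 (zf 1 a)
    simp only [zero_add, Nat.choose_one_right] at *
    rw [h3, h4]
    rcases Nat.eq_zero_or_pos a with rfl | ha
    · simp [zf_zero]
    · rw [if_neg (by omega)] at h2
      have : zf 1 a + 1 = a := by omega
      rw [this, Nat.choose_succ_succ' a]; simp
  | succ i ih =>
    intro a
    rcases Nat.eq_zero_or_pos a with rfl | ha
    · simp [zf_zero, G_zero]
    · obtain ⟨m, r, hm, rfl, hr⟩ := decomp (i+1) a ha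
      have h1 := star (i+1) m r hm hr
      have h2 := star' i m (zf (i+1) r) hm (bounds i m r hr.le).2
      have h3 := ih r
      rw [h1.1, h1.2.1, h2, h3, Nat.choose_succ_succ' (m+1)]
      try simp only [add_assoc, Nat.reduceAdd] at *
      omega

lemma galois_aux (i : ℕ) : ∀ a, 0 < a → a ≤ macaulayGrow (i+1) (sf (i+2) a) ∧ 0 < sf (i+2) a ∧
    macaulayGrow (i+1) (sf (i+2) a - 1) < a := by
  induction i with
  | zero =>
    intro a ha
    obtain ⟨m, r, hm, rfl, hr⟩ := decomp 1 a ha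
    have h1 := star 1 m r hm hr
    have h4 := fun x => G_choose 0 x
    have h5 := sf_one r
    simp only [zero_add, Nat.choose_one_right, Nat.reduceAdd] at *
    rw [h1.2.2, h4, h4, h5]
    split_ifs with h
    · subst h
      refine ⟨by simp, by omega, ?_⟩
      have : m + 0 - 1 + 1 = m := by omega
      rw [this, Nat.choose_succ_succ' m 1]
      simp
      omega
    · refine ⟨?_, by omega, ?_⟩
      · rw [Nat.choose_succ_succ' (m+1) 1]; simp; omega
      · simp; omega
  | succ i ih =>
    intro a ha
    obtain ⟨m, r, hm, rfl, hr⟩ := decomp (i+2) a ha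
    have h1 := star (i+2) m r hm hr
    have hb := (bounds (i+1) m r hr.le).1
    have h2 := star' i m (sf (i+2) r) (by omega) hb
    have hp : 0 < Nat.choose m (i+2) := Nat.choose_pos hm
    simp only [add_assoc, Nat.reduceAdd] at *
    rw [h1.2.2, h2]
    rcases Nat.eq_zero_or_pos r with rfl | hr0
    · refine ⟨by simp, by omega, ?_⟩
      simp only [sf_zero, add_zero]
      have := G_strictMono (i+1) (show Nat.choose m (i+2) - 1 < Nat.choose m (i+2) by omega)
      have h3 := G_choose (i+1) m
      try simp only [add_assoc, Nat.reduceAdd] at *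
      omega
    · obtain ⟨g1, g2, g3⟩ := ih r hr0
      refine ⟨by omega, by omega, ?_⟩
      have h3 := star' i m (sf (i+2) r - 1) (by omega) (by omega)
      rw [show Nat.choose m (i+2) + sf (i+2) r - 1 = Nat.choose m (i+2) + (sf (i+2) r - 1) by omega, h3]
      try simp only [add_assoc, Nat.reduceAdd] at *
      omega

lemma galois (i a b : ℕ) : sf (i+2) b ≤ a ↔ b ≤ macaulayGrow (i+1) a := by
  rcases Nat.eq_zero_or_pos b with rfl | hb
  · simp [sf_zero]
  obtain ⟨h1, h2, h3⟩ := galois_aux i b hb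
  constructor
  · intro h
    exact h1.trans ((G_strictMono i).monotone h)
  · intro h
    by_contra hc
    have := (G_strictMono i).monotone (show a ≤ sf (i+2) b - 1 by omega)
    omega

lemma sf_mono (i : ℕ) : Monotone (sf (i+1)) := by
  intro a b hab
  cases i with
  | zero => simp only [zero_add, sf_one]; split_ifs <;> omega
  | succ i => exact (galois i _ _).2 (hab.trans ((galois i _ _).1 le_rfl))

lemma sf_succ (i a : ℕ) : sf (i+1) (a+1) ≤ sf (i+1) a + 1 := by
  cases i with
  | zero => simp only [zero_add, sf_one]; split_ifs <;> omega
  | succ i =>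
    rw [galois]
    have := G_strict i (sf (i+2) a)
    have := (galois i _ a).1 le_rfl
    simp only [add_assoc, Nat.reduceAdd] at *
    omega

lemma zf_mono (i : ℕ) : Monotone (zf (i+1)) := by
  apply monotone_nat_of_le_succ
  intro a
  have h1 := zf_add_sf i a
  have h2 := zf_add_sf i (a+1)
  have h3 := sf_succ i a
  omega

lemma sf_pos (i a : ℕ) (ha : 0 < a) : 0 < sf (i+1) a := by
  cases i with
  | zero => simp only [zero_add, sf_one]; split_ifs <;> omega
  | succ i => exact (galois_aux i a ha).2.1

/-- numeric step of Green's theorem -/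
lemma green_num (i b0 b' : ℕ) (h : sf (i+2) b0 ≤ zf (i+1) b') : sf (i+2) (b0 + b') ≤ b' := by
  rw [galois] at h ⊢
  have := G_eq i b'
  omega

/-- numeric step for the shadow -/
lemma shadow_num (i a b : ℕ) (h : b ≤ macaulayGrow (i+1) a) :
    zf (i+2) b ≤ macaulayGrow (i+1) (zf (i+1) a) := by
  have h1 := zf_mono (i+1) h
  have h2 := zf_add_sf (i+1) (macaulayGrow (i+1) a)
  have h3 : a ≤ sf (i+2) (macaulayGrow (i+1) a) := by
    have := (galois i (sf (i+2) (macaulayGrow (i+1) a)) _).1 le_rfl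
    exact (G_strictMono i).le_iff_le.1 this
  have := G_eq i a
  simp only [add_assoc, Nat.reduceAdd] at *
  omega

end WLPaux
namespace WLPaux

section generic
variable {k : Type*} [Field k]

/-- sets open along lines -/
def LineOpen {V : Type*} [AddCommGroup V] [Module k V] (S : Set V) : Prop :=
  ∀ p ∈ S, ∀ q : V, {t : k | p + t • (q - p) ∉ S}.Finite

lemma LineOpen.inter {V : Type*} [AddCommGroup V] [Module k V] {S T : Set V}
    (hS : LineOpen (k := k) S) (hT : LineOpen (k := k) T) : LineOpen (k := k) (S ∩ T) := by
  intro p hp q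
  refine ((hS p hp.1 q).union (hT p hp.2 q)).subset ?_
  intro t ht
  simp only [Set.mem_ofPred_eq, Set.mem_inter_iff, Set.mem_union] at *
  tauto

lemma LineOpen.nonempty_inter [Infinite k] {V : Type*} [AddCommGroup V] [Module k V] {S T : Set V}
    (hS : LineOpen (k := k) S) (hT : LineOpen (k := k) T) (h1 : S.Nonempty) (h2 : T.Nonempty) :
    (S ∩ T).Nonempty := by
  obtain ⟨p, hp⟩ := h1
  obtain ⟨q, hq⟩ := h2
  have f1 := hS p hp q
  have f2 := (hT q hq p).image (fun t => 1 - t)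
  obtain ⟨t, ht⟩ := (f1.union f2).infinite_compl.nonempty
  simp only [Set.mem_compl_iff, Set.mem_union, not_or, Set.mem_ofPred_eq, not_not, Set.mem_image,
    not_exists, not_and] at ht
  refine ⟨p + t • (q - p), ht.1, ?_⟩
  by_contra hc
  apply ht.2 (1 - t) _ (by ring)
  convert hc using 2
  module

lemma lineOpen_rank {V D Q : Type*} [AddCommGroup V] [Module k V] [AddCommGroup D] [Module k D]
    [AddCommGroup Q] [Module k Q] [FiniteDimensional k Q] (F : V → (D →ₗ[k] Q))
    (hF : ∀ p q : V, ∃ A B C : D →ₗ[k] Q, ∀ t : k, F (p + t • (q - p)) = A + t • B + t ^ 2 • C)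
    (U : Submodule k D) (N : ℕ) :
    LineOpen (k := k) {p | N ≤ Module.finrank k (U.map (F p))} := by
  intro p hp q
  obtain ⟨A, B, C, hABC⟩ := hF p q
  have hA : F p = A := by simpa using hABC 0
  let b := Module.finBasis k (U.map (F p))
  set r := Module.finrank k (U.map (F p)) with hr
  have hb : ∀ j : Fin r, ∃ u ∈ U, F p u = b j := fun j => by
    have := (b j).2
    rw [Submodule.mem_map] at this
    exact this
  choose u hu hub using hb
  have hli : LinearIndependent k (fun j => (b j : Q)) :=
    b.linearIndependent.map' (Submodule.subtype _) (Submodule.ker_subtype _)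
  obtain ⟨ψ, hψ⟩ : ∃ ψ : Q →ₗ[k] (Fin r → k), ∀ j, ψ (b j) = Pi.single j 1 := by
    let L := Fintype.linearCombination k (fun j => (b j : Q))
    have hL : LinearMap.ker L = ⊥ := by
      rw [LinearMap.ker_eq_bot]
      exact linearIndependent_iff_injective_fintypeLinearCombination.1 hli
    obtain ⟨ψ, hψ⟩ := LinearMap.exists_leftInverse_of_injective L hL
    refine ⟨ψ, fun j => ?_⟩
    have := LinearMap.congr_fun hψ (Pi.single j 1)
    simpa [L, Fintype.linearCombination_apply_single] using this
  let M : Matrix (Fin r) (Fin r) (Polynomial k) := Matrix.of fun j i =>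
    Polynomial.C (ψ (A (u j)) i) + Polynomial.X * Polynomial.C (ψ (B (u j)) i)
      + Polynomial.X ^ 2 * Polynomial.C (ψ (C (u j)) i)
  have hM : ∀ t, Polynomial.eval t M.det
      = Matrix.det (Matrix.of fun j i => ψ (F (p + t • (q - p)) (u j)) i : Matrix (Fin r) (Fin r) k) := by
    intro t
    rw [← Polynomial.coe_evalRingHom, RingHom.map_det]
    congr 1
    ext j i
    simp [M, hABC]
    ring
  have hM0 : M.det ≠ 0 := by
    intro h
    have h1 := hM 0
    rw [h] at h1
    have : (Matrix.of fun j i => ψ (F (p + (0:k) • (q - p)) (u j)) i : Matrix (Fin r) (Fin r) k) = 1 := by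
      ext j i
      simp only [zero_smul, add_zero, hub, hψ, Matrix.of_apply]
      rw [Matrix.one_apply, Pi.single_apply]
      simp [eq_comm]
    rw [this, Matrix.det_one] at h1
    simp at h1
  refine (Polynomial.finite_setOfPred_isRoot hM0).subset ?_
  intro t ht
  simp only [Set.mem_ofPred_eq, Polynomial.IsRoot.def]
  by_contra hc
  apply ht
  simp only [Set.mem_ofPred_eq]
  refine le_trans hp ?_
  rw [hM] at hc
  have h2 := Matrix.linearIndependent_rows_of_det_ne_zero hc
  have h3 : LinearIndependent k (fun j => F (p + t • (q - p)) (u j)) :=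
    LinearIndependent.of_comp ψ h2
  have h4 : LinearIndependent k (fun j => (⟨F (p + t • (q - p)) (u j),
      Submodule.mem_map_of_mem (hu j)⟩ : U.map (F (p + t • (q - p))))) :=
    LinearIndependent.of_comp (Submodule.subtype _) h3
  have := h4.fintype_card_le_finrank
  simpa using this

lemma rank_nullity {D Q : Type*} [AddCommGroup D] [Module k D]
    [AddCommGroup Q] [Module k Q] [FiniteDimensional k D] (f : D →ₗ[k] Q) (U : Submodule k D) :
    Module.finrank k (U.map f) + Module.finrank k (U ⊓ LinearMap.ker f : Submodule k D)
      = Module.finrank k U := by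
  have h := LinearMap.finrank_range_add_finrank_ker (f.domRestrict U)
  rw [LinearMap.range_domRestrict, LinearMap.ker_domRestrict] at h
  rw [← h]
  congr 1
  rw [← Submodule.map_comap_subtype]
  exact (Submodule.equivMapOfInjective _ (Submodule.subtype_injective U) _).finrank_eq.symm

lemma exists_max {α : Type*} [Nonempty α] (f : α → ℕ) (N : ℕ) (h : ∀ a, f a ≤ N) :
    ∃ a, ∀ b, f b ≤ f a := by
  obtain ⟨a, ha⟩ := Nat.sSup_mem (s := Set.range f) (Set.range_nonempty f)
    ⟨N, by rintro _ ⟨a, rfl⟩; exact h a⟩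
  refine ⟨a, fun b => ?_⟩
  rw [ha]
  exact le_csSup ⟨N, by rintro _ ⟨a, rfl⟩; exact h a⟩ ⟨b, rfl⟩

variable [Infinite k] {E D : Type*} [AddCommGroup E] [Module k E] [AddCommGroup D] [Module k D]
  [FiniteDimensional k D]

theorem green (X : E →ₗ[k] (D →ₗ[k] D)) (comm : ∀ e f φ, X e (X f φ) = X f (X e φ))
    (P : ℕ → Submodule k D) (hX : ∀ e d, ∀ φ ∈ P (d+1), X e φ ∈ P d)
    (hnd : ∀ d, ∀ φ ∈ P (d+1), (∀ e, X e φ = 0) → φ = 0) (d : ℕ) :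
    ∀ U ≤ P (d+1), ∃ e, sf (d+1) (Module.finrank k U) ≤ Module.finrank k (U.map (X e)) := by
  induction d with
  | zero =>
    intro U hU
    by_cases hbot : U = ⊥
    · subst hbot; exact ⟨0, by simp [sf_zero]⟩
    · obtain ⟨φ, hφ, hφ0⟩ := Submodule.exists_mem_ne_zero_of_ne_bot hbot
      have : ∃ e, X e φ ≠ 0 := by
        by_contra hc
        push Not at hc
        exact hφ0 (hnd 0 φ (hU hφ) hc)
      obtain ⟨e, he⟩ := this
      refine ⟨e, ?_⟩
      have h1 : 0 < Module.finrank k (U.map (X e)) := by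
        rw [Module.finrank_pos_iff_exists_ne_zero]
        exact ⟨⟨X e φ, Submodule.mem_map_of_mem hφ⟩, by simpa using he⟩
      rw [zero_add, sf_one]
      split_ifs <;> omega
  | succ d ihd =>
    intro U
    induction hN : Module.finrank k U using Nat.strong_induction_on generalizing U with
    | _ N ihN =>
    intro hU
    by_cases hbot : U = ⊥
    · subst hbot
      refine ⟨0, ?_⟩
      rw [finrank_bot] at hN
      subst hN
      simp [sf_zero]
    obtain ⟨φ, hφ, hφ0⟩ := Submodule.exists_mem_ne_zero_of_ne_bot hbot
    have : ∃ e, X e φ ≠ 0 := by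
      by_contra hc
      push Not at hc
      exact hφ0 (hnd _ φ (hU hφ) hc)
    obtain ⟨e, he⟩ := this
    have h1 : 0 < Module.finrank k (U.map (X e)) := by
      rw [Module.finrank_pos_iff_exists_ne_zero]
      exact ⟨⟨X e φ, Submodule.mem_map_of_mem hφ⟩, by simpa using he⟩
    obtain ⟨e1, he1⟩ := exists_max (fun e => Module.finrank k (U.map (X e))) _
      (fun e => Submodule.finrank_map_le (X e) U)
    obtain ⟨e3, he3⟩ := exists_max (fun e : E × E => Module.finrank k (U.map (X e.1 ∘ₗ X e.2))) _
      (fun e => Submodule.finrank_map_le _ U)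
    obtain ⟨e4, he4⟩ := exists_max (fun e : E × E => Module.finrank k (U.map ((X e.1).prod (X e.2)))) _
      (fun e => Submodule.finrank_map_le _ U)
    have o1 := lineOpen_rank (k := k) (V := E × E) (fun e => X e.1)
      (fun p q => ⟨X p.1, X (q.1 - p.1), 0, fun t => by simp⟩) U (Module.finrank k (U.map (X e1)))
    have o2 := lineOpen_rank (k := k) (V := E × E) (fun e => X e.2)
      (fun p q => ⟨X p.2, X (q.2 - p.2), 0, fun t => by simp⟩) U (Module.finrank k (U.map (X e1)))
    have o3 := lineOpen_rank (k := k) (V := E × E) (fun e => X e.1 ∘ₗ X e.2)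
      (fun p q => ⟨X p.1 ∘ₗ X p.2, X p.1 ∘ₗ X (q.2 - p.2) + X (q.1 - p.1) ∘ₗ X p.2,
        X (q.1 - p.1) ∘ₗ X (q.2 - p.2), fun t => by
          ext v
          simp only [Prod.fst_add, Prod.snd_add, Prod.smul_fst, Prod.smul_snd, Prod.fst_sub,
            Prod.snd_sub, map_add, map_smul, LinearMap.comp_apply, LinearMap.add_apply,
            LinearMap.smul_apply]
          module⟩) U (Module.finrank k (U.map (X e3.1 ∘ₗ X e3.2)))
    have o4 := lineOpen_rank (k := k) (V := E × E) (fun e => (X e.1).prod (X e.2))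
      (fun p q => ⟨(X p.1).prod (X p.2), (X (q.1 - p.1)).prod (X (q.2 - p.2)), 0, fun t => by
          apply LinearMap.ext
          intro v
          simp⟩) U
          (Module.finrank k (U.map ((X e4.1).prod (X e4.2))))
    have o12 := o1.inter o2
    have o34 := o3.inter o4
    have n12 := o1.nonempty_inter o2 ⟨(e1, e1), by simp⟩ ⟨(e1, e1), by simp⟩
    have n34 := o3.nonempty_inter o4 ⟨e3, by simp⟩ ⟨e4, by simp⟩
    obtain ⟨⟨L, g⟩, ⟨a1, a2⟩, a3, a4⟩ := o12.nonempty_inter o34 n12 n34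
    simp only [Set.mem_ofPred_eq] at a1 a2 a3 a4
    have rL : Module.finrank k (U.map (X L)) = Module.finrank k (U.map (X e1)) :=
      le_antisymm (he1 L) a1
    have rg : Module.finrank k (U.map (X g)) = Module.finrank k (U.map (X e1)) :=
      le_antisymm (he1 g) a2
    have hr1 : 0 < Module.finrank k (U.map (X e1)) := lt_of_lt_of_le h1 (he1 e)
    have rn := rank_nullity (X L) U
    obtain ⟨e', he'⟩ := ihN (Module.finrank k (U ⊓ LinearMap.ker (X L) : Submodule k D))
      (by omega) (U ⊓ LinearMap.ker (X L)) rfl (inf_le_left.trans hU)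
    have rprod : ∀ f, Module.finrank k (U.map ((X L).prod (X f))) = Module.finrank k (U.map (X L))
        + Module.finrank k ((U ⊓ LinearMap.ker (X L)).map (X f)) := by
      intro f
      have r1 := rank_nullity ((X L).prod (X f)) U
      have r2 := rank_nullity (X f) (U ⊓ LinearMap.ker (X L))
      rw [LinearMap.ker_prod, ← inf_assoc] at r1
      omega
    have c1 : Module.finrank k ((U ⊓ LinearMap.ker (X L)).map (X e'))
        ≤ Module.finrank k ((U ⊓ LinearMap.ker (X L)).map (X g)) := by
      have p1 := rprod e'
      have p2 := rprod g
      have p3 := he4 (L, e')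
      simp only at p3
      omega
    obtain ⟨f', hf'⟩ := ihd (U.map (X g)) (by
      rintro _ ⟨u, hu, rfl⟩
      exact hX g _ _ (hU hu))
    have c2 : Module.finrank k ((U.map (X g)).map (X f'))
        ≤ Module.finrank k ((U.map (X g)).map (X L)) := by
      rw [← Submodule.map_comp, ← Submodule.map_comp]
      exact (he3 (f', g)).trans a3
    have rn2 := rank_nullity (X L) (U.map (X g))
    have c3 : Module.finrank k ((U ⊓ LinearMap.ker (X L)).map (X g))
        ≤ Module.finrank k ((U.map (X g)) ⊓ LinearMap.ker (X L) : Submodule k D) := by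
      apply Submodule.finrank_mono
      rintro _ ⟨u, ⟨hu1, hu2⟩, rfl⟩
      refine ⟨Submodule.mem_map_of_mem hu1, ?_⟩
      have hu2' : X L u = 0 := hu2
      simp [comm L g u, hu2']
    refine ⟨L, ?_⟩
    have hz := zf_add_sf d (Module.finrank k (U.map (X g)))
    have key := green_num d (Module.finrank k (U ⊓ LinearMap.ker (X L) : Submodule k D))
      (Module.finrank k (U.map (X L))) (by
        rw [rL]
        rw [rg] at hz hf' rn2
        simp only [add_assoc, Nat.reduceAdd] at *
        omega)
    rw [← hN, ← rn, add_comm (Module.finrank k (U.map (X L)))]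
    exact key

theorem macaulay (X : E →ₗ[k] (D →ₗ[k] D)) (comm : ∀ e f φ, X e (X f φ) = X f (X e φ))
    (P : ℕ → Submodule k D) (hX : ∀ e d, ∀ φ ∈ P (d+1), X e φ ∈ P d)
    (hnd : ∀ d, ∀ φ ∈ P (d+1), (∀ e, X e φ = 0) → φ = 0) (d : ℕ) :
    Module.finrank k (P (d+2)) ≤ macaulayGrow (d+1) (Module.finrank k (P (d+1))) := by
  rw [← galois]
  obtain ⟨e, he⟩ := green X comm P hX hnd (d+1) (P (d+2)) le_rfl
  refine he.trans (Submodule.finrank_mono ?_)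
  rintro _ ⟨u, hu, rfl⟩
  exact hX e _ u hu

end generic

end WLPaux
namespace WLPaux

section forward
variable {k : Type*} [Field k] {n : ℕ} (I : Ideal (MvPolynomial (Fin n) k))

lemma mem_piece {i : ℕ} {x : MvPolynomial (Fin n) k ⧸ I} :
    x ∈ quotPiece I i ↔ ∃ f : MvPolynomial (Fin n) k, f.IsHomogeneous i ∧ Ideal.Quotient.mk I f = x := by
  simp [quotPiece, Submodule.mem_map, mem_homogeneousSubmodule]

lemma mul_mem_piece {i : ℕ} {L : MvPolynomial (Fin n) k} (hL : L.IsHomogeneous 1)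
    {x : MvPolynomial (Fin n) k ⧸ I} (hx : x ∈ quotPiece I i) :
    Ideal.Quotient.mk I L * x ∈ quotPiece I (i+1) := by
  rw [mem_piece] at *
  obtain ⟨f, hf, rfl⟩ := hx
  exact ⟨L * f, by rw [add_comm]; exact hL.mul hf, by simp⟩

lemma piece_succ_le {i : ℕ} (W : Submodule k (MvPolynomial (Fin n) k ⧸ I))
    (h : ∀ j, ∀ x ∈ quotPiece I i, Ideal.Quotient.mk I (X j) * x ∈ W) :
    quotPiece I (i+1) ≤ W := by
  intro y hy
  rw [mem_piece] at hy
  obtain ⟨f, hf, rfl⟩ := hy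
  rw [f.as_sum, map_sum]
  refine Submodule.sum_mem _ fun u hu => ?_
  have hdeg := hf (mem_support_iff.1 hu)
  have hu0 : u ≠ 0 := by
    rintro rfl
    simp at hdeg
  obtain ⟨j, hj⟩ := Finsupp.ne_iff.1 hu0
  obtain ⟨v, rfl⟩ : ∃ v, u = Finsupp.single j 1 + v := by
    refine ⟨u - Finsupp.single j 1, ?_⟩
    rw [add_tsub_cancel_of_le]
    rw [Finsupp.single_le_iff]
    simp at hj
    omega
  have e : monomial (Finsupp.single j 1 + v) (coeff (Finsupp.single j 1 + v) f)
      = X j * monomial v (coeff (Finsupp.single j 1 + v) f) := by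
    rw [X, monomial_mul, one_mul]
  rw [e, map_mul]
  apply h
  rw [mem_piece]
  refine ⟨_, isHomogeneous_monomial _ ?_, rfl⟩
  rw [Finsupp.weight_apply] at hdeg
  simp [Finsupp.sum_add_index'] at hdeg
  rw [Finsupp.degree_apply]
  simp [Finsupp.sum] at hdeg
  omega

/-- complement of the degree-`d` piece -/
noncomputable def Wd (d : ℕ) : Submodule k (MvPolynomial (Fin n) k ⧸ I) :=
  (LinearMap.ker (homogeneousComponent (R := k) (σ := Fin n) d)).map (Ideal.Quotient.mkₐ k I).toLinearMap

lemma mem_Wd {d : ℕ} {x : MvPolynomial (Fin n) k ⧸ I} :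
    x ∈ Wd I d ↔ ∃ f : MvPolynomial (Fin n) k, homogeneousComponent d f = 0 ∧ Ideal.Quotient.mk I f = x := by
  simp [Wd, Submodule.mem_map]

lemma isCompl_Wd (hI : IsHomogeneousIdeal I) (d : ℕ) : IsCompl (Wd I d) (quotPiece I d) := by
  constructor
  · rw [Submodule.disjoint_def]
    intro x h1 h2
    rw [mem_Wd] at h1
    rw [mem_piece] at h2
    obtain ⟨f, hf, rfl⟩ := h1
    obtain ⟨g, hg, h⟩ := h2
    rw [Ideal.Quotient.eq] at h
    have := hI _ h d
    rw [map_sub, hf, sub_zero, homogeneousComponent_of_mem ((mem_homogeneousSubmodule _ _).2 hg),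
      if_pos rfl] at this
    rw [← Ideal.Quotient.eq] at h
    rw [← h, Ideal.Quotient.eq_zero_iff_mem]
    exact this
  · rw [codisjoint_iff, eq_top_iff]
    intro x _
    obtain ⟨f, rfl⟩ := Ideal.Quotient.mk_surjective x
    rw [Submodule.mem_sup]
    refine ⟨_, (mem_Wd I).2 ⟨f - homogeneousComponent d f, ?_, rfl⟩, _,
      (mem_piece I).2 ⟨homogeneousComponent d f, homogeneousComponent_isHomogeneous _ _, rfl⟩, by simp⟩
    rw [map_sub, homogeneousComponent_of_mem ((mem_homogeneousSubmodule _ _).2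
      (homogeneousComponent_isHomogeneous d f)), if_pos rfl, sub_self]

lemma mul_mem_Wd {d : ℕ} {L : MvPolynomial (Fin n) k} (hL : L.IsHomogeneous 1)
    {x : MvPolynomial (Fin n) k ⧸ I} (hx : x ∈ Wd I d) :
    Ideal.Quotient.mk I L * x ∈ Wd I (d+1) := by
  rw [mem_Wd] at *
  obtain ⟨f, hf, rfl⟩ := hx
  refine ⟨L * f, ?_, by simp⟩
  conv_lhs => rw [← sum_homogeneousComponent f]
  rw [Finset.mul_sum, map_sum]
  refine Finset.sum_eq_zero fun j _ => ?_
  have h1 : (L * homogeneousComponent j f).IsHomogeneous (1 + j) :=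
    hL.mul (homogeneousComponent_isHomogeneous _ _)
  rw [homogeneousComponent_of_mem ((mem_homogeneousSubmodule _ _).2 h1)]
  split_ifs with h
  · have : j = d := by omega
    subst this
    rw [hf, mul_zero]
  · rfl

/-- linear forms acting on the dual -/
noncomputable def act : homogeneousSubmodule (Fin n) k 1 →ₗ[k]
    (Module.Dual k (MvPolynomial (Fin n) k ⧸ I) →ₗ[k] Module.Dual k (MvPolynomial (Fin n) k ⧸ I)) :=
  Module.Dual.transpose ∘ₗ LinearMap.mul k (MvPolynomial (Fin n) k ⧸ I) ∘ₗ
    (Ideal.Quotient.mkₐ k I).toLinearMap ∘ₗ Submodule.subtype _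

lemma act_apply (e : homogeneousSubmodule (Fin n) k 1)
    (φ : Module.Dual k (MvPolynomial (Fin n) k ⧸ I)) (a : MvPolynomial (Fin n) k ⧸ I) :
    act I e φ a = φ (Ideal.Quotient.mk I e * a) := rfl

lemma act_comm (e f : homogeneousSubmodule (Fin n) k 1)
    (φ : Module.Dual k (MvPolynomial (Fin n) k ⧸ I)) :
    act I e (act I f φ) = act I f (act I e φ) := by
  refine LinearMap.ext fun a => ?_
  simp only [act_apply]
  rw [← mul_assoc, ← mul_assoc, mul_comm (Ideal.Quotient.mk I f.1)]

lemma act_mem (e : homogeneousSubmodule (Fin n) k 1) (d : ℕ)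
    (φ : Module.Dual k (MvPolynomial (Fin n) k ⧸ I)) (h : φ ∈ (Wd I (d+1)).dualAnnihilator) :
    act I e φ ∈ (Wd I d).dualAnnihilator := by
  rw [Submodule.mem_dualAnnihilator] at *
  intro w hw
  rw [act_apply]
  exact h _ (mul_mem_Wd I ((mem_homogeneousSubmodule _ _).1 e.2) hw)

lemma eq_zero_of_piece (hI : IsHomogeneousIdeal I) (d : ℕ)
    (φ : Module.Dual k (MvPolynomial (Fin n) k ⧸ I)) (h : φ ∈ (Wd I d).dualAnnihilator)
    (h2 : ∀ x ∈ quotPiece I d, φ x = 0) : φ = 0 := by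
  rw [Submodule.mem_dualAnnihilator] at h
  have : Wd I d ⊔ quotPiece I d ≤ LinearMap.ker φ := sup_le (fun x hx => h x hx) (fun x hx => h2 x hx)
  rw [(isCompl_Wd I hI d).sup_eq_top, top_le_iff, LinearMap.ker_eq_top] at this
  exact this

lemma act_nd (hI : IsHomogeneousIdeal I) (d : ℕ)
    (φ : Module.Dual k (MvPolynomial (Fin n) k ⧸ I)) (h : φ ∈ (Wd I (d+1)).dualAnnihilator)
    (h2 : ∀ e, act I e φ = 0) : φ = 0 := by
  apply eq_zero_of_piece I hI (d+1) φ h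
  have : quotPiece I (d+1) ≤ LinearMap.ker φ := by
    apply piece_succ_le
    intro j x _
    have := LinearMap.congr_fun (h2 ⟨X j, (mem_homogeneousSubmodule _ _).2 (isHomogeneous_X _ _)⟩) x
    rw [act_apply] at this
    exact this
  exact fun x hx => this hx

variable [FiniteDimensional k (MvPolynomial (Fin n) k ⧸ I)]

lemma finrank_ann (hI : IsHomogeneousIdeal I) (d : ℕ) :
    Module.finrank k (Wd I d).dualAnnihilator = hilbertFn I d := by
  have h1 := Subspace.finrank_add_finrank_dualAnnihilator_eq (Wd I d)
  have h2 := Submodule.finrank_add_eq_of_isCompl (isCompl_Wd I hI d)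
  unfold hilbertFn
  omega

lemma hilbert_grow [Infinite k] (hI : IsHomogeneousIdeal I) (d : ℕ) :
    hilbertFn I (d+2) ≤ macaulayGrow (d+1) (hilbertFn I (d+1)) := by
  have := macaulay (act I) (act_comm I) (fun d => (Wd I d).dualAnnihilator)
    (fun e d φ h => act_mem I e d φ h) (fun d φ h => act_nd I hI d φ h) d
  simpa only [finrank_ann I hI] using this

lemma le_of_inj (i : ℕ) (L : homogeneousSubmodule (Fin n) k 1)
    (h : ∀ x ∈ quotPiece I i, Ideal.Quotient.mk I L * x = 0 → x = 0) :
    Module.finrank k ((quotPiece I i).map (LinearMap.mul k _ (Ideal.Quotient.mk I L))) = hilbertFn I i := by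
  have := rank_nullity (LinearMap.mul k _ (Ideal.Quotient.mk I L)) (quotPiece I i)
  have h2 : (quotPiece I i ⊓ LinearMap.ker (LinearMap.mul k _ (Ideal.Quotient.mk I (L : MvPolynomial (Fin n) k)))) = ⊥ := by
    rw [eq_bot_iff]
    rintro x ⟨h1, h2⟩
    exact h x h1 h2
  rw [h2, finrank_bot] at this
  exact this

lemma diff_eq (hI : IsHomogeneousIdeal I) (d : ℕ) (L : homogeneousSubmodule (Fin n) k 1)
    (h : (∀ x ∈ quotPiece I d, Ideal.Quotient.mk I L * x = 0 → x = 0) ∨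
      (∀ y ∈ quotPiece I (d + 1), ∃ x ∈ quotPiece I d, Ideal.Quotient.mk I L * x = y)) :
    Module.finrank k ((Wd I (d+1)).dualAnnihilator ⊓ LinearMap.ker (act I L) : Submodule k _)
      = hilbertFn I (d+1) - hilbertFn I d := by
  rcases h with h | h
  · have h1 := le_of_inj I d L h
    set V := (quotPiece I d).map (LinearMap.mul k _ (Ideal.Quotient.mk I (L : MvPolynomial (Fin n) k))) with hV
    have h2 : ((Wd I (d+1)).dualAnnihilator ⊓ LinearMap.ker (act I L) : Submodule k _)
        = (Wd I (d+1) ⊔ V).dualAnnihilator := by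
      rw [Submodule.dualAnnihilator_sup_eq]
      ext φ
      simp only [Submodule.mem_inf, LinearMap.mem_ker]
      refine and_congr_right fun hφ => ?_
      rw [Submodule.mem_dualAnnihilator]
      constructor
      · rintro h0 _ ⟨x, hx, rfl⟩
        have := LinearMap.congr_fun h0 x
        rw [act_apply] at this
        exact this
      · intro h0
        apply eq_zero_of_piece I hI d _ (act_mem I L d φ hφ)
        intro x hx
        rw [act_apply]
        exact h0 _ ⟨x, hx, rfl⟩
    have h3 : Wd I (d+1) ⊓ V = ⊥ := by
      have h4 : V ≤ quotPiece I (d+1) := by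
        rintro _ ⟨x, hx, rfl⟩
        exact mul_mem_piece I ((mem_homogeneousSubmodule _ _).1 L.2) hx
      exact ((isCompl_Wd I hI (d+1)).disjoint.mono_right h4).eq_bot
    have h4 := Submodule.finrank_sup_add_finrank_inf_eq (Wd I (d+1)) V
    rw [h3, finrank_bot] at h4
    have h5 := Subspace.finrank_add_finrank_dualAnnihilator_eq (Wd I (d+1) ⊔ V)
    have h6 := Submodule.finrank_add_eq_of_isCompl (isCompl_Wd I hI (d+1))
    rw [h2]
    change _ + hilbertFn I (d+1) = _ at h6
    omega
  · have h2 : ((Wd I (d+1)).dualAnnihilator ⊓ LinearMap.ker (act I L) : Submodule k _) = ⊥ := by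
      rw [eq_bot_iff]
      rintro φ ⟨h1, h2⟩
      have h2' : act I L φ = 0 := h2
      apply eq_zero_of_piece I hI (d+1) φ h1
      intro y hy
      obtain ⟨x, hx, rfl⟩ := h y hy
      rw [← act_apply, h2']
      rfl
    have h3 : hilbertFn I (d+1) ≤ hilbertFn I d := by
      unfold hilbertFn
      refine le_trans (Submodule.finrank_mono (t := (quotPiece I d).map
        (LinearMap.mul k _ (Ideal.Quotient.mk I (L : MvPolynomial (Fin n) k)))) ?_) (Submodule.finrank_map_le _ _)
      intro y hy
      obtain ⟨x, hx, rfl⟩ := h y hy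
      exact ⟨x, hx, rfl⟩
    rw [h2, finrank_bot]
    omega

theorem forward [Infinite k] (hI : IsHomogeneousIdeal I) (hW : hasWLP I) (r : ℕ) (h : ℕ → ℕ)
    (h0 : h 0 = 1) (hzero : ∀ i, r < i → h i = 0) (hh : ∀ i, hilbertFn I i = h i) :
    (IsOSequence h ∧
      (∃ m : ℕ, (∀ i, i < m → h i ≤ h (i + 1)) ∧ (∀ i, m ≤ i → h (i + 1) ≤ h i)) ∧
      IsOSequence (posDiff h)) := by
  obtain ⟨L0, hL0, hL⟩ := hW
  set L : homogeneousSubmodule (Fin n) k 1 := ⟨L0, hL0⟩ with hLdef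
  refine ⟨⟨h0, ?_⟩, ?_, ⟨h0, ?_⟩⟩
  · rintro (_ | i) hi
    · omega
    · have := hilbert_grow I hI i
      simpa only [hh] using this
  · classical
    let S : ℕ → Prop := fun i =>
      ∀ y ∈ quotPiece I (i + 1), ∃ x ∈ quotPiece I i, Ideal.Quotient.mk I L0 * x = y
    have hSr : S r := by
      intro y hy
      have h1 := hh (r+1)
      rw [hzero (r+1) (by omega), hilbertFn, Submodule.finrank_eq_zero] at h1
      rw [h1, Submodule.mem_bot] at hy
      exact ⟨0, Submodule.zero_mem _, by rw [mul_zero, hy]⟩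
    have hS1 : ∀ i, S i → S (i+1) := by
      intro i hi y hy
      have : quotPiece I (i+1+1) ≤ (quotPiece I (i+1)).map
          (LinearMap.mul k _ (Ideal.Quotient.mk I L0)) := by
        apply piece_succ_le
        intro j x hx
        obtain ⟨z, hz, rfl⟩ := hi x hx
        refine ⟨Ideal.Quotient.mk I (X j) * z, mul_mem_piece I (isHomogeneous_X _ _) hz, ?_⟩
        simp only [LinearMap.mul_apply']
        ring
      obtain ⟨x, hx, rfl⟩ := this hy
      exact ⟨x, hx, rfl⟩
    have hS : ∃ i, S i := ⟨r, hSr⟩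
    have hSle : ∀ i, S i → h (i+1) ≤ h i := by
      intro i hi
      rw [← hh, ← hh]
      unfold hilbertFn
      refine le_trans (Submodule.finrank_mono (t := (quotPiece I i).map
        (LinearMap.mul k _ (Ideal.Quotient.mk I L0))) ?_) (Submodule.finrank_map_le _ _)
      intro y hy
      obtain ⟨x, hx, rfl⟩ := hi y hy
      exact ⟨x, hx, rfl⟩
    refine ⟨Nat.find hS, ?_, ?_⟩
    · intro i hi
      have h1 := (hL i).resolve_right (Nat.find_min hS hi)
      rw [← hh, ← hh, ← le_of_inj I i L h1]
      apply Submodule.finrank_mono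
      rintro _ ⟨x, hx, rfl⟩
      exact mul_mem_piece I ((mem_homogeneousSubmodule _ _).1 L.2) hx
    · intro i hi
      apply hSle
      induction i, hi using Nat.le_induction with
      | base => exact Nat.find_spec hS
      | succ i _ ih => exact hS1 i ih
  · have := macaulay (act I) (act_comm I)
      (fun d => (Wd I d).dualAnnihilator ⊓ LinearMap.ker (act I L))
      (fun e d φ h => ⟨act_mem I e d φ h.1, by
        have h2 : act I L φ = 0 := h.2
        simp [act_comm I L e φ, h2]⟩) (fun d φ h => act_nd I hI d φ h.1)
    rintro (_ | i) hi
    · omega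
    · have h1 := this i
      rw [diff_eq I hI (i+1) L (hL (i+1)), diff_eq I hI i L (hL i)] at h1
      simpa only [hh, posDiff] using h1

end forward
end WLPaux
namespace WLPaux

open Classical in
/-- initial segments of monomials of degree `d` in the variables of index at least `s` -/
noncomputable def Seg (d s a : ℕ) : Finset (ℕ →₀ ℕ) :=
  if ha : a = 0 then ∅ else
  match d with
  | 0 => {0}
  | d + 1 => (Seg d s (sf (d+1) a)).image (fun v => Finsupp.single s 1 + v)
      ∪ Seg (d+1) (s+1) (zf (d+1) a)
termination_by (d, a)
decreasing_by
  · simp_wf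
    left; omega
  · simp_wf
    right
    have := zf_add_sf d a
    have := sf_pos d a (by omega)
    omega

lemma Seg_zero (d s : ℕ) : Seg d s 0 = ∅ := by
  unfold Seg; simp

lemma Seg_deg0 (s a : ℕ) (ha : a ≠ 0) : Seg 0 s a = {0} := by
  unfold Seg; simp [ha]

lemma mem_Seg_succ (d s a : ℕ) (u : ℕ →₀ ℕ) : u ∈ Seg (d+1) s a ↔
    (∃ v ∈ Seg d s (sf (d+1) a), Finsupp.single s 1 + v = u) ∨ u ∈ Seg (d+1) (s+1) (zf (d+1) a) := by
  rcases Nat.eq_zero_or_pos a with rfl | ha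
  · simp [Seg_zero, sf_zero, zf_zero]
  · conv_lhs => unfold Seg
    rw [dif_neg (by omega)]
    simp

lemma zf_lt (d a : ℕ) (ha : 0 < a) : zf (d+1) a < a := by
  have := zf_add_sf d a
  have := sf_pos d a ha
  omega

lemma Seg_prop (d : ℕ) : ∀ a s u, u ∈ Seg d s a →
    u.degree = d ∧ (∀ j < s, u j = 0) ∧ (∀ j, s + a ≤ j → u j = 0) := by
  induction d with
  | zero =>
    intro a s u hu
    by_cases ha : a = 0
    · subst ha; simp [Seg_zero] at hu
    · rw [Seg_deg0 _ _ ha] at hu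
      simp at hu
      subst hu
      simp
  | succ d ih =>
    intro a
    induction a using Nat.strong_induction_on with
    | _ a iha =>
    intro s u hu
    rcases Nat.eq_zero_or_pos a with rfl | ha
    · simp [Seg_zero] at hu
    have hzs := zf_add_sf d a
    have hlt := zf_lt d a ha
    rw [mem_Seg_succ] at hu
    rcases hu with ⟨v, hv, rfl⟩ | hu
    · obtain ⟨h1, h2, h3⟩ := ih _ _ _ hv
      refine ⟨?_, ?_, ?_⟩
      · rw [map_add, h1, Finsupp.degree_single, add_comm]
      · intro j hj
        rw [Finsupp.add_apply, h2 j hj, Finsupp.single_apply, if_neg (by omega)]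
      · intro j hj
        rw [Finsupp.add_apply, h3 j (by omega), Finsupp.single_apply, if_neg (by omega)]
    · obtain ⟨h1, h2, h3⟩ := iha _ hlt _ _ hu
      exact ⟨h1, fun j hj => h2 j (by omega), fun j hj => h3 j (by omega)⟩

lemma Seg_card (d : ℕ) : ∀ a s, (Seg (d+1) s a).card = a := by
  classical
  induction d with
  | zero =>
    intro a
    induction a using Nat.strong_induction_on with
    | _ a iha =>
    intro s
    rcases Nat.eq_zero_or_pos a with rfl | ha
    · simp [Seg_zero]
    have e : Seg (0+1) s a = (Seg 0 s (sf (0+1) a)).image (fun v => Finsupp.single s 1 + v)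
      ∪ Seg (0+1) (s+1) (zf (0+1) a) := by
      ext u; rw [mem_Seg_succ]; simp
    have hs : sf 1 a = 1 := by rw [sf_one, if_neg (by omega)]
    rw [e, Finset.card_union_of_disjoint, Finset.card_image_of_injective _ (add_right_injective _),
      iha _ (zf_lt 0 a ha), zero_add, hs, Seg_deg0 _ _ (by omega)]
    · have := zf_add_sf 0 a
      simp only [zero_add] at this
      simp
      omega
    · rw [Finset.disjoint_left]
      intro u hu hu2
      obtain ⟨v, _, rfl⟩ := Finset.mem_image.1 hu
      have := (Seg_prop _ _ _ _ hu2).2.1 s (by omega)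
      simp at this
  | succ d ih =>
    intro a
    induction a using Nat.strong_induction_on with
    | _ a iha =>
    intro s
    rcases Nat.eq_zero_or_pos a with rfl | ha
    · simp [Seg_zero]
    have e : Seg (d+1+1) s a = (Seg (d+1) s (sf (d+1+1) a)).image (fun v => Finsupp.single s 1 + v)
      ∪ Seg (d+1+1) (s+1) (zf (d+1+1) a) := by
      ext u; rw [mem_Seg_succ]; simp
    rw [e, Finset.card_union_of_disjoint, Finset.card_image_of_injective _ (add_right_injective _),
      iha _ (zf_lt (d+1) a ha), ih, zf_add_sf]
    · rw [Finset.disjoint_left]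
      intro u hu hu2
      obtain ⟨v, _, rfl⟩ := Finset.mem_image.1 hu
      have := (Seg_prop _ _ _ _ hu2).2.1 s (by omega)
      simp at this

lemma Seg_mono (d : ℕ) : ∀ b a s u, a ≤ b → u ∈ Seg d s a → u ∈ Seg d s b := by
  induction d with
  | zero =>
    intro b a s u hab hu
    by_cases ha : a = 0
    · subst ha; simp [Seg_zero] at hu
    · rw [Seg_deg0 _ _ (by omega)] at hu ⊢
      exact hu
  | succ d ih =>
    intro b
    induction b using Nat.strong_induction_on with
    | _ b ihb =>
    intro a s u hab hu
    rcases Nat.eq_zero_or_pos b with rfl | hb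
    · have : a = 0 := by omega
      subst this; exact hu
    rw [mem_Seg_succ] at hu ⊢
    rcases hu with ⟨v, hv, rfl⟩ | hu
    · exact Or.inl ⟨v, ih _ _ _ _ (sf_mono d hab) hv, rfl⟩
    · exact Or.inr (ihb _ (zf_lt d b hb) _ _ _ (zf_mono d hab) hu)

lemma Seg_shadow (d : ℕ) : ∀ b a s u j, sf (d+1) b ≤ a → u + Finsupp.single j 1 ∈ Seg (d+1) s b →
    u ∈ Seg d s a := by
  induction d with
  | zero =>
    intro b a s u j hab hu
    have h1 := (Seg_prop _ _ _ _ hu).1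
    rw [map_add, Finsupp.degree_single] at h1
    have hu0 : u = 0 := by
      rw [← Finsupp.degree_eq_zero_iff]; omega
    have hb : b ≠ 0 := by
      rintro rfl
      simp [Seg_zero] at hu
    rw [zero_add, sf_one, if_neg hb] at hab
    rw [Seg_deg0 _ _ (by omega), hu0]
    simp
  | succ d ih =>
    intro b
    induction b using Nat.strong_induction_on with
    | _ b ihb =>
    intro a s u j hab hu
    rcases Nat.eq_zero_or_pos b with rfl | hb
    · simp [Seg_zero] at hu
    rw [mem_Seg_succ] at hu
    rcases hu with ⟨v, hv, he⟩ | hu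
    · by_cases hj : j = s
      · subst hj
        rw [add_comm] at he
        have := add_right_cancel he
        subst this
        exact Seg_mono _ _ _ _ _ hab hv
      · have hle : Finsupp.single s 1 ≤ u := by
          rw [Finsupp.single_le_iff]
          have := DFunLike.congr_fun he s
          simp [hj] at this
          omega
        obtain ⟨w, rfl⟩ := exists_add_of_le hle
        rw [add_assoc] at he
        have := add_left_cancel he
        subst this
        rw [mem_Seg_succ]
        exact Or.inl ⟨w, ih _ _ _ _ _ (sf_mono d hab) hv, rfl⟩
    · rw [mem_Seg_succ]
      right
      refine ihb _ (zf_lt (d+1) b hb) _ _ _ _ ?_ hu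
      rw [galois]
      rw [galois] at hab
      exact shadow_num d a b hab

lemma exists_order_ideal (c : ℕ → ℕ) (hc : IsOSequence c) (K : ℕ) (hK : ∀ d, c d ≤ K) :
    ∃ Nd : ℕ → Finset (Fin K →₀ ℕ), (∀ d, (Nd d).card = c d) ∧ (∀ d, ∀ u ∈ Nd d, u.degree = d) ∧
      ∀ d u j, u + Finsupp.single j 1 ∈ Nd (d+1) → u ∈ Nd d := by
  classical
  have hinj : Function.Injective (Finsupp.mapDomain (M := ℕ) (Fin.val : Fin K → ℕ)) :=
    Finsupp.mapDomain_injective Fin.val_injective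
  refine ⟨fun d => (Seg d 0 (c d)).preimage (Finsupp.mapDomain (Fin.val : Fin K → ℕ)) hinj.injOn,
    ?_, ?_, ?_⟩
  · intro d
    have : (Seg d 0 (c d)).card = c d := by
      cases d with
      | zero => rw [hc.1, Seg_deg0 _ _ (by omega)]; simp
      | succ d => exact Seg_card d _ _
    conv_rhs => rw [← this]
    rw [← Finset.card_image_of_injective _ hinj, Finset.image_preimage]
    congr 1
    rw [Finset.filter_eq_self]
    intro u hu
    refine ⟨Finsupp.comapDomain Fin.val u Fin.val_injective.injOn, ?_⟩
    apply Finsupp.mapDomain_comapDomain _ Fin.val_injective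
    intro j hj
    have h3 := (Seg_prop _ _ _ _ hu).2.2 j
    have : j < K := by
      by_contra hc'
      have := hK d
      exact (Finsupp.mem_support_iff.1 hj) (h3 (by omega))
    exact ⟨⟨j, this⟩, rfl⟩
  · intro d u hu
    rw [Finset.mem_preimage] at hu
    have := (Seg_prop _ _ _ _ hu).1
    rw [← this]
    simp [Finsupp.degree_mapDomain]
  · intro d u j hu
    rw [Finset.mem_preimage] at hu ⊢
    rw [Finsupp.mapDomain_add, Finsupp.mapDomain_single] at hu
    refine Seg_shadow d _ _ _ _ _ ?_ hu
    cases d with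
    | zero => rw [hc.1, zero_add, sf_one]; split_ifs <;> omega
    | succ d => rw [galois]; exact hc.2 (d+1) (by omega)

end WLPaux
namespace WLPaux

section monomialIdeal
variable {k : Type*} [Field k] {n : ℕ} (Mi : ℕ → Finset (Fin (n+1) →₀ ℕ))

/-- The monomial ideal whose standard monomials are the members of `Mi`. -/
def stdIdeal (k : Type*) [Field k] (hdeg : ∀ i, ∀ u ∈ Mi i, u.degree = i)
    (hdown : ∀ i u j, u + Finsupp.single j 1 ∈ Mi (i+1) → u ∈ Mi i) :
    Ideal (MvPolynomial (Fin (n+1)) k) where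
  carrier := {f | ∀ i, ∀ u ∈ Mi i, coeff u f = 0}
  add_mem' := by
    intro a b ha hb i u hu
    rw [coeff_add, ha i u hu, hb i u hu, add_zero]
  zero_mem' := by
    intro i u _
    simp
  smul_mem' := by
    intro c f hf
    rw [smul_eq_mul]
    induction c using MvPolynomial.induction_on generalizing f with
    | C a =>
      intro i u hu
      rw [coeff_C_mul, hf i u hu, mul_zero]
    | add p q hp hq =>
      intro i u hu
      rw [add_mul, coeff_add, hp hf i u hu, hq hf i u hu, add_zero]
    | mul_X p j hp =>
      rw [mul_assoc]
      apply hp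
      intro i u hu
      rw [coeff_X_mul']
      split_ifs with hj
      · have e : (u - Finsupp.single j 1) + Finsupp.single j 1 = u := by
          apply tsub_add_cancel_of_le
          rw [Finsupp.single_le_iff]
          simp at hj
          omega
        have hd := hdeg i u hu
        rw [← e, map_add, Finsupp.degree_single] at hd
        obtain ⟨i', rfl⟩ : ∃ i', i = i' + 1 := ⟨i - 1, by omega⟩
        exact hf i' _ (hdown i' _ j (by rw [e]; exact hu))
      · rfl

variable (hdeg : ∀ i, ∀ u ∈ Mi i, u.degree = i)
    (hdown : ∀ i u j, u + Finsupp.single j 1 ∈ Mi (i+1) → u ∈ Mi i)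

lemma mem_stdIdeal (f : MvPolynomial (Fin (n+1)) k) :
    f ∈ stdIdeal Mi k hdeg hdown ↔ ∀ i, ∀ u ∈ Mi i, coeff u f = 0 := Iff.rfl

lemma mem_stdIdeal_hom (f : MvPolynomial (Fin (n+1)) k) (i : ℕ) (hf : f.IsHomogeneous i) :
    f ∈ stdIdeal Mi k hdeg hdown ↔ ∀ u ∈ Mi i, coeff u f = 0 := by
  rw [mem_stdIdeal]
  refine ⟨fun h => h i, fun h j u hu => ?_⟩
  by_cases hij : j = i
  · subst hij
    exact h u hu
  · apply hf.coeff_eq_zero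
    rw [hdeg j u hu]
    exact hij

lemma std_homog : IsHomogeneousIdeal (stdIdeal Mi k hdeg hdown) := by
  intro f hf i
  rw [mem_stdIdeal] at *
  intro j u hu
  rw [coeff_homogeneousComponent]
  split_ifs
  · exact hf j u hu
  · rfl

/-- Reading off the coefficients at a finite set of monomials. -/
noncomputable def coeffMap (k : Type*) [Field k] (S : Finset (Fin (n+1) →₀ ℕ)) :
    MvPolynomial (Fin (n+1)) k →ₗ[k] (S → k) :=
  LinearMap.pi fun u => lcoeff k u.1

lemma coeffMap_apply (S : Finset (Fin (n+1) →₀ ℕ)) (f : MvPolynomial (Fin (n+1)) k) (u : S) :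
    coeffMap k S f u = coeff u.1 f := rfl

lemma std_hilbert (i : ℕ) : hilbertFn (stdIdeal Mi k hdeg hdown) i = (Mi i).card := by
  set I := stdIdeal Mi k hdeg hdown with hIdef
  let F : homogeneousSubmodule (Fin (n+1)) k i →ₗ[k] (MvPolynomial (Fin (n+1)) k ⧸ I) :=
    (Ideal.Quotient.mkₐ k I).toLinearMap ∘ₗ (homogeneousSubmodule (Fin (n+1)) k i).subtype
  let G : homogeneousSubmodule (Fin (n+1)) k i →ₗ[k] (Mi i → k) :=
    coeffMap k (Mi i) ∘ₗ (homogeneousSubmodule (Fin (n+1)) k i).subtype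
  have hr : LinearMap.range F = quotPiece I i := by
    rw [LinearMap.range_comp, Submodule.range_subtype]
    rfl
  have hk : LinearMap.ker F = LinearMap.ker G := by
    ext ⟨f, hf⟩
    rw [LinearMap.mem_ker, LinearMap.mem_ker]
    have h1 : F ⟨f, hf⟩ = 0 ↔ f ∈ I := Ideal.Quotient.eq_zero_iff_mem
    rw [h1, hIdef, mem_stdIdeal_hom Mi hdeg hdown f i hf]
    constructor
    · intro h
      funext u
      exact h u.1 u.2
    · intro h u hu
      exact congrFun h ⟨u, hu⟩
  have hs : Function.Surjective G := by
    intro w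
    refine ⟨⟨∑ u : Mi i, monomial u.1 (w u), ?_⟩, ?_⟩
    · refine Submodule.sum_mem _ fun u _ => ?_
      rw [mem_homogeneousSubmodule]
      exact isHomogeneous_monomial _ (hdeg i u.1 u.2)
    · funext v
      change coeff v.1 (∑ u : Mi i, monomial u.1 (w u)) = w v
      rw [coeff_sum, Finset.sum_eq_single v]
      · simp
      · intro b _ hb
        rw [coeff_monomial, if_neg]
        exact fun h => hb (Subtype.ext h)
      · simp
  have e : (quotPiece I i) ≃ₗ[k] (Mi i → k) :=
    (LinearEquiv.ofEq _ _ hr.symm).trans (F.quotKerEquivRange.symm.trans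
      ((Submodule.quotEquivOfEq _ _ hk).trans (G.quotKerEquivOfSurjective hs)))
  rw [hilbertFn, e.finrank_eq]
  simp

lemma std_fd (r : ℕ) (hr : ∀ i, r < i → Mi i = ∅) :
    FiniteDimensional k (MvPolynomial (Fin (n+1)) k ⧸ stdIdeal Mi k hdeg hdown) := by
  classical
  set I := stdIdeal Mi k hdeg hdown with hIdef
  let S := (Finset.range (r+1)).biUnion Mi
  let F : MvPolynomial (Fin (n+1)) k →ₗ[k] (MvPolynomial (Fin (n+1)) k ⧸ I) :=
    (Ideal.Quotient.mkₐ k I).toLinearMap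
  have hk : LinearMap.ker F = LinearMap.ker (coeffMap k S) := by
    ext f
    rw [LinearMap.mem_ker, LinearMap.mem_ker]
    have h1 : F f = 0 ↔ f ∈ I := Ideal.Quotient.eq_zero_iff_mem
    rw [h1, hIdef, mem_stdIdeal]
    constructor
    · intro h
      funext u
      obtain ⟨i, _, hi⟩ := Finset.mem_biUnion.1 u.2
      exact h i u.1 hi
    · intro h i u hu
      have hi : i < r + 1 := by
        by_contra hc
        rw [hr i (by omega)] at hu
        simp at hu
      exact congrFun h ⟨u, Finset.mem_biUnion.2 ⟨i, Finset.mem_range.2 hi, hu⟩⟩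
  have hs : Function.Surjective F := Ideal.Quotient.mk_surjective
  have e : (MvPolynomial (Fin (n+1)) k ⧸ I) ≃ₗ[k] LinearMap.range (coeffMap k S) :=
    (F.quotKerEquivOfSurjective hs).symm.trans ((Submodule.quotEquivOfEq _ _ hk).trans
      (coeffMap k S).quotKerEquivRange)
  exact Module.Finite.equiv e.symm

lemma std_wlp (hW : ∀ i, (∀ u ∈ Mi i, u + Finsupp.single 0 1 ∈ Mi (i+1)) ∨
    (∀ u ∈ Mi (i+1), u 0 ≠ 0)) : hasWLP (stdIdeal Mi k hdeg hdown) := by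
  refine ⟨X 0, isHomogeneous_X _ _, fun i => ?_⟩
  rcases hW i with h | h
  · left
    intro x hx hz
    rw [mem_piece] at hx
    obtain ⟨f, hf, rfl⟩ := hx
    rw [← map_mul, Ideal.Quotient.eq_zero_iff_mem, mem_stdIdeal] at hz
    rw [Ideal.Quotient.eq_zero_iff_mem, mem_stdIdeal_hom Mi hdeg hdown f i hf]
    intro u hu
    have := hz _ _ (h u hu)
    rwa [add_comm u, coeff_X_mul] at this
  · right
    intro y hy
    rw [mem_piece] at hy
    obtain ⟨f, hf, rfl⟩ := hy
    have hq : (f.divMonomial (Finsupp.single 0 1)).IsHomogeneous i := by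
      intro u hu
      rw [coeff_divMonomial] at hu
      have := hf hu
      rw [map_add, Finsupp.weight_single, Pi.one_apply, smul_eq_mul] at this
      omega
    refine ⟨Ideal.Quotient.mk _ (f.divMonomial (Finsupp.single 0 1)), ?_, ?_⟩
    · rw [mem_piece]
      exact ⟨_, hq, rfl⟩
    · rw [← map_mul, Ideal.Quotient.eq, mem_stdIdeal_hom Mi hdeg hdown _ (i+1)]
      · intro u hu
        have h0 := h u hu
        rw [coeff_sub, coeff_X_mul', if_pos (by simpa using h0), coeff_divMonomial,
          add_tsub_cancel_of_le, sub_self]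
        rw [Finsupp.single_le_iff]
        omega
      · refine IsHomogeneous.sub ?_ hf
        rw [add_comm i]
        exact (isHomogeneous_X _ _).mul hq

end monomialIdeal
end WLPaux
namespace WLPaux

section construction

lemma exists_pos {α : Type*} [DecidableEq α] (S : Finset α) :
    ∃ f : α → ℕ, (∀ v ∈ S, f v < S.card) ∧ (∀ v ∈ S, ∀ w ∈ S, f v = f w → v = w) ∧
      ∀ p < S.card, ∃ v ∈ S, f v = p := by
  refine ⟨fun v => if hv : v ∈ S then (S.equivFin ⟨v, hv⟩ : ℕ) else 0, ?_, ?_, ?_⟩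
  · intro v hv
    simp [hv]
  · intro v hv w hw h
    simp only [hv, hw, dif_pos] at h
    have := S.equivFin.injective (Fin.ext h)
    exact congrArg Subtype.val this
  · intro p hp
    refine ⟨(S.equivFin.symm ⟨p, hp⟩).1, (S.equivFin.symm ⟨p, hp⟩).2, ?_⟩
    simp

variable {K m : ℕ} {h : ℕ → ℕ}

lemma mono_up (hup : ∀ i, i < m → h i ≤ h (i + 1)) (a b : ℕ) (hab : a ≤ b) (hb : b ≤ m) :
    h a ≤ h b := by
  induction b, hab using Nat.le_induction with
  | base => rfl
  | succ b hab ih => exact (ih (by omega)).trans (hup b (by omega))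

lemma le_peak (hup : ∀ i, i < m → h i ≤ h (i + 1)) (hdn : ∀ i, m ≤ i → h (i + 1) ≤ h i) (i : ℕ) :
    h i ≤ h m := by
  rcases le_total i m with hi | hi
  · exact mono_up hup i m hi le_rfl
  · induction i, hi using Nat.le_induction with
    | base => rfl
    | succ b hab ih => exact (hdn b hab).trans ih

lemma exists_rho (h0 : h 0 = 1) (hup : ∀ i, i < m → h i ≤ h (i + 1))
    (hdn : ∀ i, m ≤ i → h (i + 1) ≤ h i) (Nd : ℕ → Finset (Fin K →₀ ℕ))
    (hcard : ∀ d, (Nd d).card = posDiff h d) (hNdeg : ∀ d, ∀ u ∈ Nd d, u.degree = d) :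
    ∃ ρ : (Fin K →₀ ℕ) → ℕ,
      (∀ d, ∀ v ∈ Nd d, d ≤ m ∧ (∀ e < d, h e ≤ ρ v) ∧ ρ v < h d) ∧
      (∀ d d' v w, v ∈ Nd d → w ∈ Nd d' → ρ v = ρ w → v = w) ∧
      (∀ p < h m, ∃ d, ∃ v ∈ Nd d, ρ v = p) := by
  classical
  choose pos hp1 hp2 hp3 using fun d => exists_pos (Nd d)
  have hle : ∀ d, posDiff h d ≤ h d := by
    intro d
    cases d with
    | zero => rfl
    | succ d => exact Nat.sub_le _ _
  have R1 : ∀ d, ∀ v ∈ Nd d, d ≤ m ∧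
      (∀ e < d, h e ≤ (h v.degree - posDiff h v.degree) + pos v.degree v) ∧
      (h v.degree - posDiff h v.degree) + pos v.degree v < h d := by
    intro d v hv
    rw [hNdeg d v hv]
    have h1 := hp1 d v hv
    rw [hcard] at h1
    have h2 := hle d
    have hdm : d ≤ m := by
      by_contra hc
      obtain ⟨d', rfl⟩ : ∃ d', d = d' + 1 := ⟨d - 1, by omega⟩
      have h3 := hdn d' (by omega)
      simp only [posDiff] at h1
      omega
    refine ⟨hdm, fun e he => ?_, by omega⟩
    obtain ⟨d', rfl⟩ : ∃ d', d = d' + 1 := ⟨d - 1, by omega⟩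
    have h3 := mono_up hup e d' (by omega) (by omega)
    simp only [posDiff] at *
    omega
  refine ⟨fun v => (h v.degree - posDiff h v.degree) + pos v.degree v, R1, ?_, ?_⟩
  · intro d d' v w hv hw he
    have hd := R1 d v hv
    have hd' := R1 d' w hw
    have hdd : d = d' := by
      rcases lt_trichotomy d d' with hlt | heq | hlt
      · have := hd'.2.1 d hlt
        have := hd.2.2
        simp only at he
        omega
      · exact heq
      · have := hd.2.1 d' hlt
        have := hd'.2.2
        simp only at he
        omega
    subst hdd
    simp only [hNdeg d v hv, hNdeg d w hw] at he
    exact hp2 d v hv w hw (by omega)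
  · intro p hp
    have hex : ∃ d, p < h d := ⟨m, hp⟩
    have hd := Nat.find_spec hex
    set d := Nat.find hex with hdd
    have hlt : h d - posDiff h d ≤ p := by
      rcases Nat.eq_zero_or_pos d with hz | hz
      · rw [hz]
        simp [posDiff]
      · have h1 := Nat.find_min hex (m := d - 1) (by omega)
        obtain ⟨d', hd'⟩ : ∃ d', d = d' + 1 := ⟨d - 1, by omega⟩
        rw [hd'] at h1 hd ⊢
        simp only [posDiff]
        simp only [Nat.add_sub_cancel] at h1
        omega
    obtain ⟨v, hv, hvp⟩ := hp3 d (p - (h d - posDiff h d)) (by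
      rw [hcard]
      have := hle d
      omega)
    refine ⟨d, v, hv, ?_⟩
    simp only [hNdeg d v hv, hvp]
    omega

lemma degree_cons (a : ℕ) (v : Fin K →₀ ℕ) : (Finsupp.cons a v).degree = a + v.degree := by
  rw [Finsupp.degree_eq_sum, Finsupp.degree_eq_sum, Fin.sum_univ_succ]
  simp

lemma exists_std (h0 : h 0 = 1) (hup : ∀ i, i < m → h i ≤ h (i + 1))
    (hdn : ∀ i, m ≤ i → h (i + 1) ≤ h i) (Nd : ℕ → Finset (Fin K →₀ ℕ))
    (hcard : ∀ d, (Nd d).card = posDiff h d) (hNdeg : ∀ d, ∀ u ∈ Nd d, u.degree = d)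
    (hNdown : ∀ d u j, u + Finsupp.single j 1 ∈ Nd (d+1) → u ∈ Nd d) :
    ∃ Mi : ℕ → Finset (Fin (K+1) →₀ ℕ), (∀ i, (Mi i).card = h i) ∧
      (∀ i, ∀ u ∈ Mi i, u.degree = i) ∧
      (∀ i u j, u + Finsupp.single j 1 ∈ Mi (i+1) → u ∈ Mi i) ∧
      (∀ i, (∀ u ∈ Mi i, u + Finsupp.single 0 1 ∈ Mi (i+1)) ∨ (∀ u ∈ Mi (i+1), u 0 ≠ 0)) := by
  classical
  obtain ⟨ρ, R1, R2, R3⟩ := exists_rho h0 hup hdn Nd hcard hNdeg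
  let T : ℕ → Finset (Fin K →₀ ℕ) := fun i =>
    ((Finset.range (m+1)).biUnion Nd).filter (fun v => ρ v < h i)
  have hT : ∀ i v, v ∈ T i ↔ ∃ d, v ∈ Nd d ∧ ρ v < h i := by
    intro i v
    simp only [T, Finset.mem_filter, Finset.mem_biUnion, Finset.mem_range]
    constructor
    · rintro ⟨⟨d, _, hv⟩, hr⟩
      exact ⟨d, hv, hr⟩
    · rintro ⟨d, hv, hr⟩
      have := (R1 d v hv).1
      exact ⟨⟨d, by omega, hv⟩, hr⟩
  have hle : ∀ i d v, v ∈ Nd d → ρ v < h i → d ≤ i := by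
    intro i d v hv hr
    by_contra hc
    have := (R1 d v hv).2.1 i (by omega)
    omega
  let Mi : ℕ → Finset (Fin (K+1) →₀ ℕ) := fun i =>
    (T i).image (fun v => Finsupp.cons (i - v.degree) v)
  have hM : ∀ i u, u ∈ Mi i ↔ ∃ d v, v ∈ Nd d ∧ ρ v < h i ∧ d ≤ i ∧ u = Finsupp.cons (i - d) v := by
    intro i u
    simp only [Mi, Finset.mem_image, hT]
    constructor
    · rintro ⟨v, ⟨d, hv, hr⟩, rfl⟩
      exact ⟨d, v, hv, hr, hle i d v hv hr, by rw [hNdeg d v hv]⟩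
    · rintro ⟨d, v, hv, hr, _, rfl⟩
      exact ⟨v, ⟨d, hv, hr⟩, by rw [hNdeg d v hv]⟩
  refine ⟨Mi, ?_, ?_, ?_, ?_⟩
  · intro i
    have e1 : (Mi i).card = (T i).card := by
      apply Finset.card_image_of_injective
      intro v w hvw
      have := congrArg Finsupp.tail hvw
      simpa [Finsupp.tail_cons] using this
    have e2 : (T i).image ρ = Finset.range (h i) := by
      ext p
      simp only [Finset.mem_image, hT, Finset.mem_range]
      constructor
      · rintro ⟨v, ⟨d, hv, hr⟩, rfl⟩
        exact hr
      · intro hp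
        obtain ⟨d, v, hv, rfl⟩ := R3 p (hp.trans_le (le_peak hup hdn i))
        exact ⟨v, ⟨d, hv, hp⟩, rfl⟩
    rw [e1, ← Finset.card_range (h i), ← e2, Finset.card_image_of_injOn]
    intro v hv w hw hvw
    rw [Finset.mem_coe, hT] at hv hw
    obtain ⟨d, hv, _⟩ := hv
    obtain ⟨d', hw, _⟩ := hw
    exact R2 d d' v w hv hw hvw
  · intro i u hu
    rw [hM] at hu
    obtain ⟨d, v, hv, hr, hd, rfl⟩ := hu
    rw [degree_cons, hNdeg d v hv]
    omega
  · intro i u j hu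
    rw [hM] at hu ⊢
    obtain ⟨d, v, hv, hr, hd, he⟩ := hu
    have hz : u 0 + (Finsupp.single j 1 : Fin (K+1) →₀ ℕ) 0 = i + 1 - d := by
      rw [← Finsupp.add_apply, he, Finsupp.cons_zero]
    have hs : ∀ l : Fin K, u l.succ + (Finsupp.single j 1 : Fin (K+1) →₀ ℕ) l.succ = v l := by
      intro l
      rw [← Finsupp.add_apply, he, Finsupp.cons_succ]
    refine Fin.cases (motive := fun j => u 0 + (Finsupp.single j 1 : Fin (K+1) →₀ ℕ) 0 = i + 1 - d →
      (∀ l : Fin K, u l.succ + (Finsupp.single j 1 : Fin (K+1) →₀ ℕ) l.succ = v l) → _) ?_ ?_ j hz hs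
    · intro hz hs
      have ht : u.tail = v := by
        ext l
        rw [Finsupp.tail_apply, ← hs l]
        simp
      simp only [Finsupp.single_eq_same] at hz
      refine ⟨d, v, hv, ?_, by omega, ?_⟩
      · obtain ⟨a1, a2, a3⟩ := R1 d v hv
        rcases Nat.lt_or_ge i m with him | him
        · exact a3.trans_le (mono_up hup d i (by omega) (by omega))
        · exact hr.trans_le (hdn i him)
      · rw [← Finsupp.cons_tail u, ht]
        congr 1
        omega
    · intro j hz hs
      have ht : u.tail + Finsupp.single j 1 = v := by
        ext l
        rw [← hs l]
        simp [Finsupp.tail_apply, Finsupp.single_apply]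
      have hdv := hNdeg d v hv
      rw [← ht, map_add, Finsupp.degree_single] at hdv
      obtain ⟨d', rfl⟩ : ∃ d', d = d' + 1 := ⟨d - 1, by omega⟩
      have hv' : u.tail ∈ Nd d' := hNdown d' _ j (by rw [ht]; exact hv)
      have hz' : u 0 = i + 1 - (d' + 1) := by
        rw [← hz]
        simp
      refine ⟨d', u.tail, hv', ?_, by omega, ?_⟩
      · obtain ⟨a1, a2, a3⟩ := R1 _ v hv
        obtain ⟨b1, b2, b3⟩ := R1 _ _ hv'
        rcases Nat.lt_or_ge i m with him | him
        · exact b3.trans_le (mono_up hup d' i (by omega) (by omega))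
        · have := hdn i him
          have := a2 d' (by omega)
          omega
      · nth_rewrite 1 [← Finsupp.cons_tail u]
        congr 1
        omega
  · intro i
    rcases Nat.lt_or_ge i m with him | him
    · left
      intro u hu
      rw [hM] at hu ⊢
      obtain ⟨d, v, hv, hr, hd, rfl⟩ := hu
      refine ⟨d, v, hv, hr.trans_le (hup i him), by omega, ?_⟩
      ext l
      refine Fin.cases ?_ ?_ l
      · simp
        omega
      · intro l
        simp
    · right
      intro u hu
      rw [hM] at hu
      obtain ⟨d, v, hv, hr, hd, rfl⟩ := hu
      have := (R1 d v hv).1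
      rw [Finsupp.cons_zero]
      omega

end construction

theorem backward (k : Type*) [Field k] (r : ℕ) (h : ℕ → ℕ) (h0 : h 0 = 1)
    (hzero : ∀ i, r < i → h i = 0)
    (hm : ∃ m : ℕ, (∀ i, i < m → h i ≤ h (i + 1)) ∧ (∀ i, m ≤ i → h (i + 1) ≤ h i))
    (hc : IsOSequence (posDiff h)) :
    ∃ (n : ℕ) (I : Ideal (MvPolynomial (Fin n) k)),
        IsHomogeneousIdeal I ∧ FiniteDimensional k (MvPolynomial (Fin n) k ⧸ I) ∧
        (∀ i : ℕ, hilbertFn I i = h i) ∧ hasWLP I := by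
  obtain ⟨m, hup, hdn⟩ := hm
  have hK : ∀ d, posDiff h d ≤ h m := by
    intro d
    refine le_trans ?_ (le_peak hup hdn d)
    cases d with
    | zero => rfl
    | succ d => exact Nat.sub_le _ _
  obtain ⟨Nd, n1, n2, n3⟩ := exists_order_ideal (posDiff h) hc (h m) hK
  obtain ⟨Mi, m1, m2, m3, m4⟩ := exists_std h0 hup hdn Nd n1 n2 n3
  refine ⟨h m + 1, stdIdeal Mi k m2 m3, std_homog Mi m2 m3, std_fd Mi m2 m3 r ?_, ?_,
    std_wlp Mi m2 m3 m4⟩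
  · intro i hi
    rw [← Finset.card_eq_zero, m1, hzero i hi]
  · intro i
    rw [std_hilbert, m1]

end WLPaux

theorem wlp_hilbert_function_characterization
    (k : Type) [Field k] [IsAlgClosed k] [CharZero k]
    (r : ℕ) (h : ℕ → ℕ) (h0 : h 0 = 1)
    (hpos : ∀ i ≤ r, 0 < h i) (hzero : ∀ i, r < i → h i = 0) :
    (∃ (n : ℕ) (I : Ideal (MvPolynomial (Fin n) k)),
        IsHomogeneousIdeal I ∧ FiniteDimensional k (MvPolynomial (Fin n) k ⧸ I) ∧
        (∀ i : ℕ, hilbertFn I i = h i) ∧ hasWLP I) ↔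
    (IsOSequence h ∧
      (∃ m : ℕ, (∀ i, i < m → h i ≤ h (i + 1)) ∧ (∀ i, m ≤ i → h (i + 1) ≤ h i)) ∧
      IsOSequence (posDiff h)) := by
  constructor
  · rintro ⟨n, I, hI, hfd, hh, hW⟩
    exact WLPaux.forward I hI hW r h h0 hzero hh
  · rintro ⟨_, hm, hc⟩
    exact WLPaux.backward k r h h0 hzero hm hc
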